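/- arXiv:0802.2147 — 4 statements merged into one kernel-verified Lean document; each statement's English description precedes it below -/
import Mathlib

section
/- Every nonzero finite-dimensional representation X of a quiver admits a unique scss subrepresentation, i.e., a unique subrepresentation U whose slope is maximal among slopes of nonzero subrepresentations of X and which has maximal total dimension among subrepresentations achieving that maximal slope. -/
/-! Basic framework for finite-dimensional representations of a quiver.
A quiver is given by a vertex type `I`, an arrow type `A` and
source/target maps `src tgt : A → I`. -/

noncomputable section QuiverModuli

variable (𝕜 : Type) [Field 𝕜] {I A : Type} (src tgt : A → I)

/-- A finite-dimensional representation of the quiver `(I, A, src, tgt)` over `𝕜`. -/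
structure QRep where
  V : I → Type
  [grp : ∀ i, AddCommGroup (V i)]
  [mod : ∀ i, Module 𝕜 (V i)]
  [fin : ∀ i, FiniteDimensional 𝕜 (V i)]
  map : ∀ a : A, V (src a) →ₗ[𝕜] V (tgt a)

attribute [instance] QRep.grp QRep.mod QRep.fin

variable {𝕜 src tgt}

namespace QRep

/-- The dimension vector of a representation. -/
def dimVec (X : QRep 𝕜 src tgt) (i : I) : ℕ := Module.finrank 𝕜 (X.V i)

variable [Fintype I]

/-- The total dimension of a representation. -/
def totalDim (X : QRep 𝕜 src tgt) : ℕ := ∑ i, X.dimVec i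

/-- A representation is nonzero if its total dimension is nonzero. -/
def Nonzero (X : QRep 𝕜 src tgt) : Prop := X.totalDim ≠ 0

/-- The slope `μ(X) = Θ(dim X)/dim X` of a representation w.r.t. a stability `Θ`. -/
def slope (Θ : I → ℤ) (X : QRep 𝕜 src tgt) : ℚ :=
  (∑ i, (Θ i : ℚ) * (X.dimVec i : ℚ)) / (X.totalDim : ℚ)

end QRep

/-- Morphisms of representations. -/
structure QHom (X Y : QRep 𝕜 src tgt) where
  f : ∀ i, X.V i →ₗ[𝕜] Y.V i
  comm : ∀ a : A, (f (tgt a)).comp (X.map a) = (Y.map a).comp (f (src a))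

/-- A short exact sequence `0 → X → Y → Z → 0` of representations. -/
structure QSES (X Y Z : QRep 𝕜 src tgt) where
  ι : QHom X Y
  π : QHom Y Z
  inj : ∀ i, Function.Injective (ι.f i)
  surj : ∀ i, Function.Surjective (π.f i)
  exact : ∀ i, LinearMap.range (ι.f i) = LinearMap.ker (π.f i)

/-- A subrepresentation: a family of submodules closed under the structure maps. -/
structure Subrep (X : QRep 𝕜 src tgt) where
  sub : ∀ i, Submodule 𝕜 (X.V i)
  closed : ∀ a : A, (sub (src a)).map (X.map a) ≤ sub (tgt a)

namespace Subrep

variable {X : QRep 𝕜 src tgt}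

def dimVec (U : Subrep X) (i : I) : ℕ := Module.finrank 𝕜 (U.sub i)

variable [Fintype I]

def totalDim (U : Subrep X) : ℕ := ∑ i, U.dimVec i

def Nonzero (U : Subrep X) : Prop := U.totalDim ≠ 0

/-- A subrepresentation is proper if it is not the whole representation. -/
def Proper (U : Subrep X) : Prop := ∃ i, U.sub i ≠ ⊤

def slope (Θ : I → ℤ) (U : Subrep X) : ℚ :=
  (∑ i, (Θ i : ℚ) * (U.dimVec i : ℚ)) / (U.totalDim : ℚ)

/-- Containment of subrepresentations. -/
def Le (U W : Subrep X) : Prop := ∀ i, U.sub i ≤ W.sub i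

end Subrep

variable {X Y : QRep 𝕜 src tgt}

/-- The subrepresentation viewed as a representation in its own right. -/
def Subrep.toRep (U : Subrep X) : QRep 𝕜 src tgt where
  V i := ↥(U.sub i)
  map a := (X.map a).restrict (fun x hx => U.closed a ⟨x, hx, rfl⟩)

/-- The quotient representation `X/U`. -/
def Subrep.quotRep (U : Subrep X) : QRep 𝕜 src tgt where
  V i := X.V i ⧸ U.sub i
  map a := Submodule.mapQ (U.sub (src a)) (U.sub (tgt a)) (X.map a)
    (Submodule.map_le_iff_le_comap.mp (U.closed a))

/-- The full subrepresentation. -/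
def Subrep.top (X : QRep 𝕜 src tgt) : Subrep X :=
  ⟨fun _ => ⊤, fun _ => le_top⟩

/-- The subquotient representation `W/U` for `U ≤ W ≤ X`. -/
def Subrep.subquotRep (U W : Subrep X) (h : U.Le W) : QRep 𝕜 src tgt where
  V i := ↥(W.sub i) ⧸ (U.sub i).comap (W.sub i).subtype
  map a := Submodule.mapQ _ _ ((X.map a).restrict (fun x hx => W.closed a ⟨x, hx, rfl⟩))
    (by
      intro x hx
      rw [Submodule.mem_comap] at hx ⊢
      exact U.closed a ⟨x.1, hx, rfl⟩)

/-- The kernel of a morphism, as a subrepresentation of the source. -/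
def QHom.kerSub (f : QHom X Y) : Subrep X where
  sub i := LinearMap.ker (f.f i)
  closed a := by
    rintro y ⟨x, hx, rfl⟩
    have h := congrArg (fun g => g x) (f.comm a)
    simp only [LinearMap.coe_comp, Function.comp_apply] at h
    simp only [LinearMap.mem_ker] at hx ⊢
    rw [h, hx, map_zero]

/-- The image of a morphism, as a subrepresentation of the target. -/
def QHom.imSub (f : QHom X Y) : Subrep Y where
  sub i := LinearMap.range (f.f i)
  closed a := by
    rintro y ⟨z, ⟨x, rfl⟩, rfl⟩
    have h := congrArg (fun g => g x) (f.comm a)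
    simp only [LinearMap.coe_comp, Function.comp_apply] at h
    exact ⟨X.map a x, h⟩

variable [Fintype I]

/-- Semistability: every nonzero subrepresentation has slope at most the slope of `X`. -/
def QRep.Semistable (Θ : I → ℤ) (X : QRep 𝕜 src tgt) : Prop :=
  ∀ U : Subrep X, U.Nonzero → U.slope Θ ≤ X.slope Θ

/-- Stability: every nonzero proper subrepresentation has slope strictly less
than the slope of `X`. -/
def QRep.Stable (Θ : I → ℤ) (X : QRep 𝕜 src tgt) : Prop :=
  ∀ U : Subrep X, U.Nonzero → U.Proper → U.slope Θ < X.slope Θ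

/-- `U` is a scss (strongly contradicting semistability) subrepresentation of `X`:
nonzero, of maximal slope among nonzero subrepresentations, and of maximal total
dimension among those of maximal slope. -/
def Subrep.IsScss (Θ : I → ℤ) (U : Subrep X) : Prop :=
  U.Nonzero ∧ (∀ V : Subrep X, V.Nonzero → V.slope Θ ≤ U.slope Θ) ∧
    (∀ V : Subrep X, V.Nonzero → V.slope Θ = U.slope Θ → V.totalDim ≤ U.totalDim)

/-- A Harder–Narasimhan filtration `0 = F 0 ⊆ F 1 ⊆ ... ⊆ F s = X` with semistable
subquotients of strictly decreasing slopes. -/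
structure HNFilt (Θ : I → ℤ) (X : QRep 𝕜 src tgt) where
  s : ℕ
  F : ℕ → Subrep X
  mono : ∀ k, (F k).Le (F (k + 1))
  bot : ∀ i, (F 0).sub i = ⊥
  top : ∀ i, (F s).sub i = ⊤
  strict : ∀ k, k < s → ∃ i, (F k).sub i < (F (k + 1)).sub i
  sst : ∀ k, k < s → QRep.Semistable Θ (Subrep.subquotRep (F k) (F (k + 1)) (mono k))
  desc : ∀ k, k + 1 < s →
    QRep.slope Θ (Subrep.subquotRep (F (k + 1)) (F (k + 2)) (mono (k + 1))) <
    QRep.slope Θ (Subrep.subquotRep (F k) (F (k + 1)) (mono k))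

/-- The slope of the `(k+1)`-st subquotient of a HN filtration (the `(k+1)`-st weight). -/
def HNFilt.wt {Θ : I → ℤ} (H : HNFilt Θ X) (k : ℕ) : ℚ :=
  QRep.slope Θ (Subrep.subquotRep (H.F k) (H.F (k + 1)) (H.mono k))

/-- The `ℚ`-indexed piece `X^{(a)}` of a HN filtration, at vertex `i`. -/
def HNFilt.piece {Θ : I → ℤ} (H : HNFilt Θ X) (a : ℚ) (i : I) : Submodule 𝕜 (X.V i) :=
  ⨆ k ∈ {k : ℕ | k < H.s ∧ a ≤ H.wt k}, (H.F (k + 1)).sub i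

/-- All HN weights of `X` are `≥ a`. -/
def QRep.weightsGe (Θ : I → ℤ) (a : ℚ) (X : QRep 𝕜 src tgt) : Prop :=
  ∀ H : HNFilt Θ X, ∀ k, k < H.s → a ≤ H.wt k

/-- All HN weights of `X` are `< a`. -/
def QRep.weightsLt (Θ : I → ℤ) (a : ℚ) (X : QRep 𝕜 src tgt) : Prop :=
  ∀ H : HNFilt Θ X, ∀ k, k < H.s → H.wt k < a


namespace Subrep

section

omit [Fintype I]

@[ext]
theorem ext {U W : Subrep X} (h : ∀ i, U.sub i = W.sub i) : U = W := by
  cases U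
  cases W
  congr
  exact funext h

/-- The sum of two subrepresentations. -/
def sup (U W : Subrep X) : Subrep X where
  sub i := U.sub i ⊔ W.sub i
  closed a := by
    rw [Submodule.map_sup]
    exact sup_le_sup (U.closed a) (W.closed a)

/-- The intersection of two subrepresentations. -/
def inf (U W : Subrep X) : Subrep X where
  sub i := U.sub i ⊓ W.sub i
  closed a := (Submodule.map_inf_le _).trans (inf_le_inf (U.closed a) (W.closed a))

theorem dimVec_sup_add_dimVec_inf (U W : Subrep X) (i : I) :
    (U.sup W).dimVec i + (U.inf W).dimVec i = U.dimVec i + W.dimVec i :=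
  Submodule.finrank_sup_add_finrank_inf_eq (U.sub i) (W.sub i)

theorem dimVec_mono {U W : Subrep X} (h : U.Le W) (i : I) : U.dimVec i ≤ W.dimVec i :=
  Submodule.finrank_mono (h i)

theorem dimVec_le (U : Subrep X) (i : I) : U.dimVec i ≤ X.dimVec i :=
  Submodule.finrank_le (U.sub i)

theorem sup_comm (U W : Subrep X) : U.sup W = W.sup U :=
  ext fun _ => _root_.sup_comm _ _

end

theorem finite_range_dimVec : (Set.range (dimVec (X := X))).Finite := by
  classical
  refine (Set.finite_Iic X.dimVec).subset ?_
  rintro _ ⟨U, rfl⟩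
  exact U.dimVec_le

theorem nonzero_top (hX : X.Nonzero) : (top X).Nonzero := by
  have h : (top X).totalDim = X.totalDim := Finset.sum_congr rfl fun _ _ => finrank_top _ _
  exact h.trans_ne hX

theorem eq_of_le_of_totalDim_le {U W : Subrep X} (h : U.Le W)
    (hd : W.totalDim ≤ U.totalDim) : U = W := by
  have hsum : U.totalDim = W.totalDim :=
    le_antisymm (Finset.sum_le_sum fun i _ => dimVec_mono h i) hd
  have hdim := (Finset.sum_eq_sum_iff_of_le fun i _ => dimVec_mono h i).mp hsum
  ext1 i
  exact Submodule.eq_of_le_of_finrank_eq (h i) (hdim i (Finset.mem_univ i))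

/-- The additive function `Θ(dim U) - m * dim U`, whose sign compares the slope of `U`
with `m`. -/
def excess (Θ : I → ℤ) (m : ℚ) (U : Subrep X) : ℚ :=
  ∑ i, ((Θ i : ℚ) - m) * (U.dimVec i : ℚ)

theorem excess_eq (Θ : I → ℤ) (m : ℚ) (U : Subrep X) :
    U.excess Θ m = ∑ i, (Θ i : ℚ) * (U.dimVec i : ℚ) - m * U.totalDim := by
  simp [excess, totalDim, sub_mul, Finset.mul_sum]

theorem excess_sup_add_excess_inf (Θ : I → ℤ) (m : ℚ) (U W : Subrep X) :
    (U.sup W).excess Θ m + (U.inf W).excess Θ m = U.excess Θ m + W.excess Θ m := by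
  simp only [excess, ← Finset.sum_add_distrib, ← mul_add]
  exact_mod_cast Finset.sum_congr rfl fun i _ => by rw [dimVec_sup_add_dimVec_inf]

theorem excess_eq_zero_of_not_nonzero (Θ : I → ℤ) (m : ℚ) {U : Subrep X} (hU : ¬ U.Nonzero) :
    U.excess Θ m = 0 := by
  have h : ∀ i, U.dimVec i = 0 := by
    simpa [Subrep.Nonzero, totalDim] using hU
  simp [excess, h]

theorem Nonzero.totalDim_pos {U : Subrep X} (hU : U.Nonzero) : (0 : ℚ) < U.totalDim :=
  Nat.cast_pos.mpr (Nat.pos_of_ne_zero hU)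

theorem excess_nonpos_iff (Θ : I → ℤ) (m : ℚ) {U : Subrep X} (hU : U.Nonzero) :
    U.excess Θ m ≤ 0 ↔ U.slope Θ ≤ m := by
  rw [excess_eq, slope, div_le_iff₀ hU.totalDim_pos, sub_nonpos]

theorem excess_eq_zero_iff (Θ : I → ℤ) (m : ℚ) {U : Subrep X} (hU : U.Nonzero) :
    U.excess Θ m = 0 ↔ U.slope Θ = m := by
  rw [excess_eq, slope, div_eq_iff hU.totalDim_pos.ne', sub_eq_zero]

theorem IsScss.excess_nonpos {Θ : I → ℤ} {U : Subrep X} (hU : U.IsScss Θ) (W : Subrep X) :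
    W.excess Θ (U.slope Θ) ≤ 0 := by
  by_cases hW : W.Nonzero
  · exact (excess_nonpos_iff Θ _ hW).mpr (hU.2.1 W hW)
  · exact (excess_eq_zero_of_not_nonzero Θ _ hW).le

theorem IsScss.sup_eq {Θ : I → ℤ} {U W : Subrep X} (hU : U.IsScss Θ) (hW : W.Nonzero)
    (hs : W.slope Θ = U.slope Θ) : U = U.sup W := by
  have hle : U.Le (U.sup W) := fun i => le_sup_left
  have hne : (U.sup W).Nonzero := fun h => hU.1 <|
    Nat.eq_zero_of_le_zero (h ▸ Finset.sum_le_sum fun i _ => dimVec_mono hle i)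
  refine eq_of_le_of_totalDim_le hle (hU.2.2 _ hne ((excess_eq_zero_iff Θ _ hne).mp ?_))
  have h := excess_sup_add_excess_inf Θ (U.slope Θ) U W
  rw [(excess_eq_zero_iff Θ _ hU.1).mpr rfl, (excess_eq_zero_iff Θ _ hW).mpr hs] at h
  linarith [hU.excess_nonpos (U.sup W), hU.excess_nonpos (U.inf W)]

theorem IsScss.eq {Θ : I → ℤ} {U W : Subrep X} (hU : U.IsScss Θ) (hW : W.IsScss Θ) :
    U = W := by
  have hs : W.slope Θ = U.slope Θ := le_antisymm (hU.2.1 W hW.1) (hW.2.1 U hU.1)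
  rw [hU.sup_eq hW.1 hs, sup_comm, ← hW.sup_eq hU.1 hs.symm]

theorem exists_isScss (Θ : I → ℤ) (hX : X.Nonzero) : ∃ U : Subrep X, U.IsScss Θ := by
  let f : (I → ℕ) → ℚ ×ₗ ℕ := fun d =>
    toLex ((∑ i, (Θ i : ℚ) * (d i : ℚ)) / ((∑ i, d i : ℕ) : ℚ), ∑ i, d i)
  obtain ⟨_, ⟨U, hU, rfl⟩, hmax⟩ :=
    Set.exists_max_image (dimVec '' {U : Subrep X | U.Nonzero}) f
      (finite_range_dimVec.subset (Set.image_subset_range _ _)) ⟨_, top X, nonzero_top hX, rfl⟩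
  have key (V : Subrep X) (hV : V.Nonzero) :
      V.slope Θ < U.slope Θ ∨ V.slope Θ = U.slope Θ ∧ V.totalDim ≤ U.totalDim :=
    Prod.Lex.toLex_le_toLex.mp (hmax _ ⟨V, hV, rfl⟩)
  exact ⟨U, hU, fun V hV => (key V hV).elim le_of_lt fun h => h.1.le,
    fun V hV h => (key V hV).elim (fun hlt => absurd h hlt.ne) And.right⟩

end Subrep

/-- Every nonzero representation admits a unique scss
subrepresentation. -/
theorem scss_exists_unique (Θ : I → ℤ) {X : QRep 𝕜 src tgt} (hX : X.Nonzero) :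
    ∃! U : Subrep X, U.IsScss Θ := by
  obtain ⟨U, hU⟩ := Subrep.exists_isScss Θ hX
  exact ⟨U, hU, fun _ hV => hV.eq hU⟩


end QuiverModuli
end

section
/- Every finite-dimensional representation X of a quiver possesses a unique Harder–Narasimhan filtration: a filtration 0 = X_0 ⊂ X_1 ⊂ ... ⊂ X_s = X such that each subquotient X_i/X_{i-1} is semistable and μ(X_1/X_0) > μ(X_2/X_1) > ... > μ(X_s/X_{s-1}). -/
/-! Basic framework for finite-dimensional representations of a quiver.
A quiver is given by a vertex type `I`, an arrow type `A` and
source/target maps `src tgt : A → I`. -/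

noncomputable section QuiverModuli

variable (𝕜 : Type) [Field 𝕜] {I A : Type} (src tgt : A → I)

variable {𝕜 src tgt}

variable {X Y : QRep 𝕜 src tgt}

variable [Fintype I]

section LatticeHN

variable {L : Type*} [Lattice L] [BoundedOrder L] (θ d : L → ℚ)

/-- The slope of the interval from `U` to `W`, for a degree `θ` and a dimension `d`. -/
def relSlope (U W : L) : ℚ := (θ W - θ U) / (d W - d U)

/-- Semistability of the interval from `U` to `W`. -/
def RelSemistable (U W : L) : Prop :=
  ∀ V, U < V → V ≤ W → relSlope θ d U V ≤ relSlope θ d U W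

/-- The chain `⊥ = F 0 < F 1 < ⋯ < F s = ⊤` is a Harder–Narasimhan filtration. -/
structure IsHNChain (s : ℕ) (F : ℕ → L) : Prop where
  bot : F 0 = ⊥
  top : F s = ⊤
  mono : ∀ k, F k ≤ F (k + 1)
  strict : ∀ k < s, F k < F (k + 1)
  sst : ∀ k < s, RelSemistable θ d (F k) (F (k + 1))
  desc : ∀ k, k + 1 < s → relSlope θ d (F (k + 1)) (F (k + 2)) < relSlope θ d (F k) (F (k + 1))

variable {θ d}

omit [BoundedOrder L] in
theorem relSlope_le_iff (hd : StrictMono d) {U V : L} (h : U < V) {m : ℚ} :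
    relSlope θ d U V ≤ m ↔ θ V - θ U ≤ m * (d V - d U) :=
  div_le_iff₀ (sub_pos.2 (hd h))

omit [BoundedOrder L] in
theorem relSlope_lt_iff (hd : StrictMono d) {U V : L} (h : U < V) {m : ℚ} :
    relSlope θ d U V < m ↔ θ V - θ U < m * (d V - d U) :=
  div_lt_iff₀ (sub_pos.2 (hd h))

omit [BoundedOrder L] in
theorem le_relSlope_iff (hd : StrictMono d) {U V : L} (h : U < V) {m : ℚ} :
    m ≤ relSlope θ d U V ↔ m * (d V - d U) ≤ θ V - θ U :=
  le_div_iff₀ (sub_pos.2 (hd h))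

/-- Above every `U ≠ ⊤` there is an element of maximal slope over `U`, of maximal dimension
among those. -/
theorem exists_relScss (hfin : (Set.range fun U => (θ U, d U)).Finite) {U : L} (hU : U ≠ ⊤) :
    ∃ W, U < W ∧ ∀ V, U < V → relSlope θ d U V ≤ relSlope θ d U W ∧
      (relSlope θ d U W ≤ relSlope θ d U V → d V ≤ d W) := by
  obtain ⟨_, ⟨W, hW, rfl⟩, hmax⟩ := Set.exists_max_image
    ((fun U => (θ U, d U)) '' Set.Ioi U)
    (fun p => toLex ((p.1 - θ U) / (p.2 - d U), p.2))
    (hfin.subset (Set.image_subset_range _ _)) ⟨_, ⊤, lt_top_iff_ne_top.2 hU, rfl⟩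
  refine ⟨W, hW, fun V hV => ?_⟩
  have h := hmax _ ⟨V, hV, rfl⟩
  rw [Prod.Lex.toLex_le_toLex] at h
  rcases h with h | h
  · exact ⟨h.le, fun h' => absurd h (not_lt.2 h')⟩
  · exact ⟨h.1.le, fun _ => h.2⟩

theorem exists_isHNChain (hd : StrictMono d)
    (hfin : (Set.range fun U => (θ U, d U)).Finite) : ∃ s F, IsHNChain θ d s F := by
  classical
  choose! next hlt hmax using fun U (hU : U ≠ ⊤) => exists_relScss (θ := θ) (d := d) hfin hU
  let step : L → L := fun U => if U = ⊤ then ⊤ else next U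
  let F : ℕ → L := fun k => step^[k] ⊥
  have hF : ∀ k, F (k + 1) = step (F k) := fun k => Function.iterate_succ_apply' ..
  have hF' : ∀ k, F k ≠ ⊤ → F (k + 1) = next (F k) := fun k hk => by
    rw [hF]; exact if_neg hk
  have hex : ∃ k, F k = ⊤ := by
    by_contra! hne
    have hmono : StrictMono fun k => d (F k) :=
      strictMono_nat_of_lt_succ fun k => hd (by rw [hF' k (hne k)]; exact hlt _ (hne k))
    refine Set.infinite_range_of_injective hmono.injective ((hfin.image Prod.snd).subset ?_)
    rintro _ ⟨k, rfl⟩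
    exact ⟨_, ⟨F k, rfl⟩, rfl⟩
  have hne : ∀ k < Nat.find hex, F k ≠ ⊤ := fun k hk => Nat.find_min hex hk
  have hstrict : ∀ k, F k ≠ ⊤ → F k < F (k + 1) := fun k hk => by
    rw [hF' k hk]; exact hlt _ hk
  refine ⟨Nat.find hex, F, rfl, Nat.find_spec hex, fun k => ?_, fun k hk => hstrict k (hne k hk),
    fun k hk V hV _ => ?_, fun k hk => ?_⟩
  · by_cases hk : F k = ⊤
    · rw [hF, hk]; simp [step]
    · exact (hstrict k hk).le
  · rw [hF' k (hne k hk)]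
    exact (hmax _ (hne k hk) V hV).1
  · have h0 := hne k (by omega)
    have h01 := hstrict k h0
    have h12 := hstrict (k + 1) (hne _ hk)
    have h := hmax _ h0 _ (h01.trans h12)
    rw [← hF' k h0] at h
    by_contra! hle
    refine absurd (h.2 ?_) (not_le.2 (hd h12))
    rw [le_relSlope_iff hd h12] at hle
    rw [le_relSlope_iff hd (h01.trans h12)]
    have h1 := (le_relSlope_iff hd h01).1 (le_refl (relSlope θ d (F k) (F (k + 1))))
    linarith

namespace IsHNChain

variable {s s' : ℕ} {F F' : ℕ → L}

theorem relSlope_lt (H : IsHNChain θ d s F) {k j : ℕ} (hkj : k < j) (hj : j < s) :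
    relSlope θ d (F j) (F (j + 1)) < relSlope θ d (F k) (F (k + 1)) := by
  induction j, hkj using Nat.le_induction with
  | base => exact H.desc k hj
  | succ j _ ih => exact (H.desc j hj).trans (ih (by omega))

theorem relSlope_le_and_le (H : IsHNChain θ d s F) (hd : StrictMono d)
    (hθm : ∀ U V, θ (U ⊔ V) + θ (U ⊓ V) = θ U + θ V)
    (hdm : ∀ U V, d (U ⊔ V) + d (U ⊓ V) = d U + d V) {k : ℕ} (hk : k < s) {V : L}
    (hV : F k < V) :
    relSlope θ d (F k) V ≤ relSlope θ d (F k) (F (k + 1)) ∧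
      (relSlope θ d (F k) (F (k + 1)) ≤ relSlope θ d (F k) V → V ≤ F (k + 1)) := by
  set m := relSlope θ d (F k) (F (k + 1)) with hm
  have key : ∀ j, k + 1 ≤ j → j ≤ s →
      θ (V ⊓ F j) - θ (F k) ≤ m * (d (V ⊓ F j) - d (F k)) ∧
      (m * (d (V ⊓ F j) - d (F k)) ≤ θ (V ⊓ F j) - θ (F k) → V ⊓ F j ≤ F (k + 1)) := by
    intro j hj
    induction j, hj using Nat.le_induction with
    | base =>
      refine fun _ => ⟨?_, fun _ => inf_le_right⟩
      rcases (le_inf hV.le (H.mono k)).eq_or_lt with h | h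
      · rw [← h]; simp
      · exact (relSlope_le_iff hd h).1 (H.sst k hk _ h inf_le_right)
    | succ j hkj ih =>
      intro hj
      obtain ⟨ih₁, ih₂⟩ := ih (by omega)
      have hinf : V ⊓ F (j + 1) ⊓ F j = V ⊓ F j := by
        rw [inf_assoc, inf_eq_right.2 (H.mono j)]
      by_cases hle : V ⊓ F (j + 1) ≤ F j
      · rw [inf_eq_left.2 hle] at hinf
        rw [hinf]
        exact ⟨ih₁, ih₂⟩
      · have hlt : F j < V ⊓ F (j + 1) ⊔ F j := right_lt_sup.2 hle
        have h := (H.sst j hj _ hlt (sup_le inf_le_right (H.mono j))).trans_lt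
          (H.relSlope_lt hkj hj)
        rw [relSlope_lt_iff hd hlt, ← hm] at h
        have h₁ := hθm (V ⊓ F (j + 1)) (F j)
        have h₂ := hdm (V ⊓ F (j + 1)) (F j)
        rw [hinf] at h₁ h₂
        have h₃ : θ (V ⊓ F (j + 1)) - θ (F k) < m * (d (V ⊓ F (j + 1)) - d (F k)) := by
          have e₁ : d (V ⊓ F (j + 1) ⊔ F j) - d (F j) = d (V ⊓ F (j + 1)) - d (V ⊓ F j) := by
            linarith
          rw [e₁] at h
          linarith
        exact ⟨h₃.le, fun h' => absurd h₃ (not_lt.2 h')⟩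
  have h := key s hk le_rfl
  rw [H.top, inf_top_eq] at h
  rwa [relSlope_le_iff hd hV, le_relSlope_iff hd hV]

theorem le_and_eq (H : IsHNChain θ d s F) (H' : IsHNChain θ d s' F') (hd : StrictMono d)
    (hθm : ∀ U V, θ (U ⊔ V) + θ (U ⊓ V) = θ U + θ V)
    (hdm : ∀ U V, d (U ⊔ V) + d (U ⊓ V) = d U + d V) {k : ℕ} (hk : k ≤ s) :
    k ≤ s' ∧ F k = F' k := by
  induction k with
  | zero => exact ⟨Nat.zero_le _, H.bot.trans H'.bot.symm⟩
  | succ k ih =>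
    obtain ⟨hk', heq⟩ := ih (by omega)
    have hlt := H.strict k hk
    have hks' : k < s' := by
      refine hk'.lt_of_ne ?_
      rintro rfl
      rw [heq, H'.top] at hlt
      exact not_top_lt hlt
    have hlt' := H'.strict k hks'
    rw [← heq] at hlt'
    have h := H.relSlope_le_and_le hd hθm hdm hk hlt'
    have h' := H'.relSlope_le_and_le hd hθm hdm hks' (heq ▸ hlt)
    rw [← heq] at h'
    exact ⟨hks', le_antisymm (h'.2 h.1) (h.2 h'.1)⟩

end IsHNChain

end LatticeHN

theorem LinearMap.finrank_comap_of_surjective {K M N : Type*} [Field K] [AddCommGroup M]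
    [Module K M] [FiniteDimensional K M] [AddCommGroup N] [Module K N] (f : M →ₗ[K] N)
    (hf : Function.Surjective f) (S : Submodule K N) :
    Module.finrank K (S.comap f) = Module.finrank K S + Module.finrank K (LinearMap.ker f) := by
  have h := (f.domRestrict (S.comap f)).finrank_range_add_finrank_ker
  rw [LinearMap.range_domRestrict, Submodule.map_comap_eq_of_surjective hf,
    LinearMap.ker_domRestrict] at h
  rw [← h, ← (Submodule.comapSubtypeEquivOfLe (LinearMap.ker_le_comap f)).finrank_eq]

namespace Subrep

omit [Fintype I] in
theorem sub_injective : Function.Injective (Subrep.sub : Subrep X → _) := by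
  rintro ⟨_, _⟩ ⟨_, _⟩ rfl
  rfl

end Subrep

instance : Max (Subrep X) where
  max U W := ⟨fun i => U.sub i ⊔ W.sub i, fun a => by
    rw [Submodule.map_sup]; exact sup_le_sup (U.closed a) (W.closed a)⟩

instance : Min (Subrep X) where
  min U W := ⟨fun i => U.sub i ⊓ W.sub i, fun a =>
    (Submodule.map_inf_le _).trans (inf_le_inf (U.closed a) (W.closed a))⟩

instance : LE (Subrep X) := ⟨Subrep.Le⟩

instance : LT (Subrep X) := ⟨fun U W => U.sub < W.sub⟩

instance : Lattice (Subrep X) :=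
  Subrep.sub_injective.lattice _ Iff.rfl Iff.rfl (fun _ _ => rfl) (fun _ _ => rfl)

instance : BoundedOrder (Subrep X) where
  top := Subrep.top X
  le_top _ _ := le_top
  bot := ⟨fun _ => ⊥, fun _ => by rw [Submodule.map_bot]⟩
  bot_le _ _ := bot_le

namespace Subrep

/-- The degree `Θ(dim U)`. -/
def deg (Θ : I → ℤ) (U : Subrep X) : ℚ := ∑ i, (Θ i : ℚ) * (U.dimVec i : ℚ)

/-- The total dimension as a rational number. -/
def rdim (U : Subrep X) : ℚ := U.totalDim

theorem slope_eq (Θ : I → ℤ) (U : Subrep X) : U.slope Θ = U.deg Θ / U.rdim := rfl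

theorem rdim_eq_sum (U : Subrep X) : U.rdim = ∑ i, (U.dimVec i : ℚ) := by
  simp [rdim, totalDim]

theorem rdim_strictMono : StrictMono (rdim : Subrep X → ℚ) := by
  intro U W h
  obtain ⟨hle, i, hi⟩ := Pi.lt_def.1 (show U.sub < W.sub from h)
  exact Nat.cast_lt.2 (Finset.sum_lt_sum (fun i _ => Submodule.finrank_mono (hle i))
    ⟨i, Finset.mem_univ i, Submodule.finrank_lt_finrank_of_lt hi⟩)

omit [Fintype I] in
theorem dimVec_sup_add_inf (U W : Subrep X) (i : I) :
    ((U ⊔ W).dimVec i : ℚ) + (U ⊓ W).dimVec i = U.dimVec i + W.dimVec i :=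
  mod_cast Submodule.finrank_sup_add_finrank_inf_eq (U.sub i) (W.sub i)

theorem deg_sup_add_inf (Θ : I → ℤ) (U W : Subrep X) :
    (U ⊔ W).deg Θ + (U ⊓ W).deg Θ = U.deg Θ + W.deg Θ := by
  simp only [deg, ← Finset.sum_add_distrib, ← mul_add, dimVec_sup_add_inf]

theorem rdim_sup_add_inf (U W : Subrep X) :
    (U ⊔ W).rdim + (U ⊓ W).rdim = U.rdim + W.rdim := by
  simp only [rdim_eq_sum, ← Finset.sum_add_distrib, dimVec_sup_add_inf]

theorem finite_range_deg_rdim (Θ : I → ℤ) :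
    (Set.range fun U : Subrep X => (U.deg Θ, U.rdim)).Finite := by
  classical
  refine ((Set.finite_Iic X.dimVec).image fun v : I → ℕ =>
    (∑ i, (Θ i : ℚ) * (v i : ℚ), ((∑ i, v i : ℕ) : ℚ))).subset ?_
  rintro _ ⟨U, rfl⟩
  exact ⟨U.dimVec, fun i => Submodule.finrank_le _, rfl⟩

section Subquotient

variable {U W : Subrep X} (h : U.Le W)

/-- The subrepresentation of `X` between `U` and `W` corresponding to one of `W/U`. -/
def pull (S : Subrep (subquotRep U W h)) : Subrep X where
  sub i := ((S.sub i).comap (Submodule.mkQ _)).map (W.sub i).subtype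
  closed a := by
    rintro _ ⟨_, ⟨x, hx, rfl⟩, rfl⟩
    exact ⟨⟨X.map a x, W.closed a ⟨x, x.2, rfl⟩⟩, S.closed a ⟨_, hx, rfl⟩, rfl⟩

/-- The subrepresentation `V/U` of `W/U`. -/
def push (V : Subrep X) : Subrep (subquotRep U W h) where
  sub i := ((V.sub i).comap (W.sub i).subtype).map (Submodule.mkQ _)
  closed a := by
    rintro _ ⟨_, ⟨x, hx, rfl⟩, rfl⟩
    exact ⟨⟨X.map a x, W.closed a ⟨x, x.2, rfl⟩⟩, V.closed a ⟨_, hx, rfl⟩, rfl⟩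

omit [Fintype I] in
theorem pull_le (S : Subrep (subquotRep U W h)) : pull h S ≤ W :=
  fun _ => Submodule.map_subtype_le _ _

omit [Fintype I] in
theorem le_pull (S : Subrep (subquotRep U W h)) : U ≤ pull h S := fun i x hx =>
  ⟨⟨x, h i hx⟩, by
    have : (Submodule.Quotient.mk ⟨x, h i hx⟩ :
        (W.sub i) ⧸ (U.sub i).comap (W.sub i).subtype) = 0 :=
      (Submodule.Quotient.mk_eq_zero _).2 hx
    change (Submodule.Quotient.mk ⟨x, h i hx⟩ :
        (W.sub i) ⧸ (U.sub i).comap (W.sub i).subtype) ∈ S.sub i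
    rw [this]
    exact (S.sub i).zero_mem, rfl⟩

omit [Fintype I] in
theorem pull_push {V : Subrep X} (hUV : U ≤ V) (hVW : V ≤ W) : pull h (push h V) = V := by
  refine sub_injective (funext fun i => ?_)
  change Submodule.map _ (Submodule.comap _ (Submodule.map _ _)) = _
  rw [Submodule.comap_map_mkQ, sup_eq_right.2 (Submodule.comap_mono (hUV i)),
    Submodule.map_comap_subtype, inf_eq_right.2 (hVW i)]

omit [Fintype I] in
include h in
theorem finrank_comap_subtype (i : I) :
    Module.finrank 𝕜 ((U.sub i).comap (W.sub i).subtype) = U.dimVec i :=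
  (Submodule.comapSubtypeEquivOfLe (h i)).finrank_eq

omit [Fintype I] in
theorem dimVec_pull (S : Subrep (subquotRep U W h)) (i : I) :
    (pull h S).dimVec i = S.dimVec i + U.dimVec i := by
  rw [← finrank_comap_subtype h i]
  refine (LinearEquiv.finrank_eq (Submodule.equivSubtypeMap _ _)).symm.trans ?_
  refine (LinearMap.finrank_comap_of_surjective _ (Submodule.mkQ_surjective _) _).trans ?_
  rw [Submodule.ker_mkQ]
  rfl

omit [Fintype I] in
theorem dimVec_subquotRep (i : I) :
    ((subquotRep U W h).dimVec i : ℚ) = W.dimVec i - U.dimVec i := by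
  have := Submodule.finrank_quotient_add_finrank ((U.sub i).comap (W.sub i).subtype)
  rw [finrank_comap_subtype h i] at this
  exact eq_sub_of_add_eq (mod_cast this)

theorem slope_subquotRep (Θ : I → ℤ) :
    (subquotRep U W h).slope Θ = relSlope (deg Θ) rdim U W := by
  simp only [QRep.slope, QRep.totalDim, Nat.cast_sum, dimVec_subquotRep, relSlope, deg,
    rdim_eq_sum, mul_sub, Finset.sum_sub_distrib]

theorem deg_pull (Θ : I → ℤ) (S : Subrep (subquotRep U W h)) :
    (pull h S).deg Θ = S.deg Θ + U.deg Θ := by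
  simp only [deg, dimVec_pull, Nat.cast_add, mul_add, Finset.sum_add_distrib]

theorem rdim_pull (S : Subrep (subquotRep U W h)) :
    (pull h S).rdim = S.rdim + U.rdim := by
  simp only [rdim_eq_sum, dimVec_pull, Nat.cast_add, Finset.sum_add_distrib]

theorem relSlope_pull (Θ : I → ℤ) (S : Subrep (subquotRep U W h)) :
    relSlope (deg Θ) rdim U (pull h S) = S.slope Θ := by
  rw [relSlope, deg_pull, rdim_pull, add_sub_cancel_right, add_sub_cancel_right, slope_eq]

theorem lt_pull_iff (S : Subrep (subquotRep U W h)) : U < pull h S ↔ S.Nonzero := by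
  have hS : S.Nonzero ↔ S.rdim ≠ 0 := Nat.cast_ne_zero.symm
  rw [hS, (le_pull h S).lt_iff_ne, not_iff_not]
  have := rdim_pull h S
  refine ⟨fun e => ?_, fun e => ?_⟩
  · rw [← e] at this; linarith
  · by_contra hne
    have := rdim_strictMono ((le_pull h S).lt_of_ne hne)
    linarith

theorem semistable_subquotRep_iff (Θ : I → ℤ) :
    (subquotRep U W h).Semistable Θ ↔ RelSemistable (deg Θ) rdim U W := by
  rw [QRep.Semistable, RelSemistable, slope_subquotRep]
  refine ⟨fun H V hUV hVW => ?_, fun H S hS => ?_⟩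
  · have e := pull_push h hUV.le hVW
    rw [← e, lt_pull_iff] at hUV
    rw [← e, relSlope_pull]
    exact H _ hUV
  · rw [← relSlope_pull h]
    exact H _ ((lt_pull_iff h S).2 hS) (pull_le h S)

end Subquotient

omit [Fintype I] in
theorem exists_sub_lt_iff {U W : Subrep X} (h : U ≤ W) :
    (∃ i, U.sub i < W.sub i) ↔ U < W :=
  ⟨fun hi => Pi.lt_def.2 ⟨h, hi⟩, fun hlt => (Pi.lt_def.1 (show U.sub < W.sub from hlt)).2⟩

end Subrep

theorem HNFilt.isHNChain {Θ : I → ℤ} (H : HNFilt Θ X) :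
    IsHNChain (Subrep.deg Θ) Subrep.rdim H.s H.F where
  bot := Subrep.sub_injective (funext H.bot)
  top := Subrep.sub_injective (funext H.top)
  mono := H.mono
  strict k hk := (Subrep.exists_sub_lt_iff (H.mono k)).1 (H.strict k hk)
  sst k hk := (Subrep.semistable_subquotRep_iff _ Θ).1 (H.sst k hk)
  desc k hk := by
    simpa only [Subrep.slope_subquotRep] using H.desc k hk

/-- A Harder–Narasimhan chain of subrepresentations, as a Harder–Narasimhan filtration. -/
def HNFilt.ofIsHNChain {Θ : I → ℤ} {s : ℕ} {F : ℕ → Subrep X}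
    (H : IsHNChain (Subrep.deg Θ) Subrep.rdim s F) : HNFilt Θ X where
  s := s
  F := F
  mono := H.mono
  bot i := by rw [H.bot]; rfl
  top i := by rw [H.top]; rfl
  strict k hk := (Subrep.exists_sub_lt_iff (H.mono k)).2 (H.strict k hk)
  sst k hk := (Subrep.semistable_subquotRep_iff _ Θ).2 (H.sst k hk)
  desc k hk := by
    simpa only [Subrep.slope_subquotRep] using H.desc k hk

/-- Every representation possesses a Harder–Narasimhan
filtration, and it is unique. -/
theorem hn_exists_unique (Θ : I → ℤ) (X : QRep 𝕜 src tgt) :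
    Nonempty (HNFilt Θ X) ∧
    ∀ H H' : HNFilt Θ X,
      H.s = H'.s ∧ ∀ k ≤ H.s, ∀ i, (H.F k).sub i = (H'.F k).sub i := by
  refine ⟨?_, fun H H' => ?_⟩
  · obtain ⟨s, F, h⟩ := exists_isHNChain (Subrep.rdim_strictMono (X := X))
      (Subrep.finite_range_deg_rdim Θ)
    exact ⟨HNFilt.ofIsHNChain h⟩
  · have key : ∀ (H H' : HNFilt Θ X) (k : ℕ), k ≤ H.s → k ≤ H'.s ∧ H.F k = H'.F k :=
      fun H H' k hk => H.isHNChain.le_and_eq H'.isHNChain Subrep.rdim_strictMono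
        (Subrep.deg_sup_add_inf Θ) Subrep.rdim_sup_add_inf hk
    refine ⟨le_antisymm (key H H' _ le_rfl).1 (key H' H _ le_rfl).1, fun k hk i => ?_⟩
    rw [(key H H' k hk).2]


end QuiverModuli
end

section
/- Any morphism f : X → Y of quiver representations respects the Q-indexed Harder–Narasimhan filtration: f(X^{(a)}) ⊆ Y^{(a)} for all a ∈ Q. -/
/-! Basic framework for finite-dimensional representations of a quiver.
A quiver is given by a vertex type `I`, an arrow type `A` and
source/target maps `src tgt : A → I`. -/

noncomputable section QuiverModuli

variable (𝕜 : Type) [Field 𝕜] {I A : Type} (src tgt : A → I)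

variable {𝕜 src tgt}

variable {X Y : QRep 𝕜 src tgt}

variable [Fintype I]

/-- The degree `Θ(dim U)` of a subrepresentation is at most `q * dim U` whenever its slope is at
most `q`; the zero subrepresentation satisfies this for every `q`. -/
theorem Subrep.degree_le_mul_totalDim {Θ : I → ℤ} {U : Subrep X} {q : ℚ}
    (h : U.Nonzero → U.slope Θ ≤ q) :
    ∑ i, (Θ i : ℚ) * (U.dimVec i : ℚ) ≤ q * (U.totalDim : ℚ) := by
  by_cases hU : U.totalDim = 0
  · have h0 : ∀ i, U.dimVec i = 0 := fun i =>
      Finset.sum_eq_zero_iff.mp hU i (Finset.mem_univ i)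
    simp [hU, h0]
  · exact (div_le_iff₀ (by positivity)).mp (h hU)

/-- There is no nonzero morphism between semistable representations of decreasing slope. -/
theorem QHom.eq_zero_of_slope_lt {Θ : I → ℤ} (f : QHom X Y) (hX : X.Semistable Θ)
    (hY : Y.Semistable Θ) (hlt : Y.slope Θ < X.slope Θ) (i : I) : f.f i = 0 := by
  by_cases him : f.imSub.totalDim = 0
  · have h0 : f.imSub.dimVec i = 0 := Finset.sum_eq_zero_iff.mp him i (Finset.mem_univ i)
    exact LinearMap.range_eq_bot.mp (Submodule.finrank_eq_zero.mp h0)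
  exfalso
  have hker := Subrep.degree_le_mul_totalDim (hX f.kerSub)
  have himle := Subrep.degree_le_mul_totalDim (hY f.imSub)
  have hpos : (0 : ℚ) < f.imSub.totalDim := by positivity
  have hadd : ∀ i, f.imSub.dimVec i + f.kerSub.dimVec i = X.dimVec i := fun i =>
    LinearMap.finrank_range_add_finrank_ker (f.f i)
  have hdim : f.imSub.totalDim + f.kerSub.totalDim = X.totalDim := by
    simp only [Subrep.totalDim, QRep.totalDim, ← Finset.sum_add_distrib, hadd]
  have hdeg : ∑ i, (Θ i : ℚ) * (f.imSub.dimVec i : ℚ) + ∑ i, (Θ i : ℚ) * (f.kerSub.dimVec i : ℚ)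
      = ∑ i, (Θ i : ℚ) * (X.dimVec i : ℚ) := by
    rw [← Finset.sum_add_distrib]
    refine Finset.sum_congr rfl fun i _ => ?_
    rw [← hadd i]
    push_cast
    ring
  have hXpos : (X.totalDim : ℚ) ≠ 0 := by
    have : X.totalDim ≠ 0 := by omega
    exact_mod_cast this
  have hXdeg : X.slope Θ * (X.totalDim : ℚ) = ∑ i, (Θ i : ℚ) * (X.dimVec i : ℚ) :=
    div_mul_cancel₀ _ hXpos
  rw [← hdeg, ← hdim] at hXdeg
  push_cast at hXdeg
  linarith [mul_lt_mul_of_pos_right hlt hpos]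

/-- The morphism `W/U → W'/U'` of subquotients induced by a morphism `f` with `f(U) ⊆ U'` and
`f(W) ⊆ W'`. -/
def QHom.subquotMap (f : QHom X Y) {U W : Subrep X} {U' W' : Subrep Y} (h : U.Le W)
    (h' : U'.Le W') (hU : ∀ i, ∀ x ∈ U.sub i, f.f i x ∈ U'.sub i)
    (hW : ∀ i, ∀ x ∈ W.sub i, f.f i x ∈ W'.sub i) :
    QHom (Subrep.subquotRep U W h) (Subrep.subquotRep U' W' h') where
  f i := Submodule.mapQ ((U.sub i).comap (W.sub i).subtype) ((U'.sub i).comap (W'.sub i).subtype)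
    ((f.f i).restrict (hW i)) fun x hx => hU i x hx
  comm a := by
    refine Submodule.linearMap_qext _ (LinearMap.ext fun x => ?_)
    refine congrArg (Submodule.Quotient.mk (p := (U'.sub (tgt a)).comap (W'.sub (tgt a)).subtype))
      (Subtype.ext ?_)
    exact LinearMap.congr_fun (f.comm a) x

/-- If `f(U) ⊆ U'` and `f(W) ⊆ W'` with `W/U` and `W'/U'` semistable of decreasing slope, then
already `f(W) ⊆ U'`. -/
theorem QHom.mem_of_slope_subquotRep_lt {Θ : I → ℤ} (f : QHom X Y) {U W : Subrep X}
    {U' W' : Subrep Y} (h : U.Le W) (h' : U'.Le W')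
    (hU : ∀ i, ∀ x ∈ U.sub i, f.f i x ∈ U'.sub i) (hW : ∀ i, ∀ x ∈ W.sub i, f.f i x ∈ W'.sub i)
    (hs : (Subrep.subquotRep U W h).Semistable Θ) (hs' : (Subrep.subquotRep U' W' h').Semistable Θ)
    (hlt : (Subrep.subquotRep U' W' h').slope Θ < (Subrep.subquotRep U W h).slope Θ)
    (i : I) (x : X.V i) (hx : x ∈ W.sub i) : f.f i x ∈ U'.sub i := by
  have h0 := LinearMap.congr_fun ((f.subquotMap h h' hU hW).eq_zero_of_slope_lt hs hs' hlt i)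
    (Submodule.Quotient.mk ⟨x, hx⟩)
  have hmem : (⟨f.f i x, hW i x hx⟩ : W'.sub i) ∈ (U'.sub i).comap (W'.sub i).subtype :=
    (Submodule.Quotient.mk_eq_zero _).mp h0
  exact hmem

namespace HNFilt

variable {Θ : I → ℤ}

theorem sub_mono (H : HNFilt Θ X) (i : I) : Monotone fun k => (H.F k).sub i :=
  monotone_nat_of_le_succ fun k => H.mono k i

theorem wt_le_wt (H : HNFilt Θ X) {k m : ℕ} (hkm : k ≤ m) (hm : m < H.s) : H.wt m ≤ H.wt k := by
  induction m, hkm using Nat.le_induction with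
  | base => exact le_rfl
  | succ m _ ih => exact (H.desc m hm).le.trans (ih (by omega))

/-- A morphism maps `F k` into `G j` if all weights of `F` below `k` are at least `a` and all
weights of `G` from `j` on are less than `a`. -/
theorem map_mem_of_wt (HX : HNFilt Θ X) (HY : HNFilt Θ Y) (f : QHom X Y) {a : ℚ} {j : ℕ}
    (hj : j ≤ HY.s) (hY : ∀ m, j ≤ m → m < HY.s → HY.wt m < a) {k : ℕ} (hk : k ≤ HX.s)
    (hX : ∀ l < k, a ≤ HX.wt l) (i : I) (x : X.V i) (hx : x ∈ (HX.F k).sub i) :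
    f.f i x ∈ (HY.F j).sub i := by
  induction k generalizing i with
  | zero =>
    rw [HX.bot i, Submodule.mem_bot] at hx
    simp [hx]
  | succ k ihk =>
    have hF : ∀ i, ∀ x ∈ (HX.F k).sub i, f.f i x ∈ (HY.F j).sub i :=
      ihk (by omega) fun l hl => hX l (by omega)
    have hG : ∀ m ≤ HY.s, j ≤ m → ∀ i, ∀ x ∈ (HX.F (k + 1)).sub i, f.f i x ∈ (HY.F m).sub i := by
      intro m hm
      induction hm using Nat.decreasingInduction with
      | self => intro _ i x _; simp [HY.top i]
      | of_succ m hm ih =>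
        intro hjm
        exact f.mem_of_slope_subquotRep_lt (HX.mono k) (HY.mono m)
          (fun i x hx => HY.sub_mono i hjm (hF i x hx)) (ih (by omega)) (HX.sst k hk) (HY.sst m hm)
          ((hY m hjm hm).trans_le (hX k (by omega)))
    exact hG j hj le_rfl i x hx

end HNFilt

/-- Any morphism of representations respects the `ℚ`-indexed
Harder–Narasimhan filtration: `f(X^{(a)}) ⊆ Y^{(a)}` for all `a ∈ ℚ`. -/
theorem hom_respects_hn_filtration (Θ : I → ℤ) {X Y : QRep 𝕜 src tgt}
    (f : QHom X Y) (HX : HNFilt Θ X) (HY : HNFilt Θ Y) (a : ℚ) (i : I) :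
    (HX.piece a i).map (f.f i) ≤ HY.piece a i := by
  classical
  have hex : ∃ j, HY.s ≤ j ∨ HY.wt j < a := ⟨HY.s, Or.inl le_rfl⟩
  obtain ⟨j, hj, hmin⟩ : ∃ j, (HY.s ≤ j ∨ HY.wt j < a) ∧ ∀ m < j, m < HY.s ∧ a ≤ HY.wt m :=
    ⟨Nat.find hex, Nat.find_spec hex, fun m hm => by simpa using Nat.find_min hex hm⟩
  have hjs : j ≤ HY.s := by
    by_contra! h
    exact (hmin HY.s h).1.false
  have hY : ∀ m, j ≤ m → m < HY.s → HY.wt m < a := fun m hjm hm =>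
    (HY.wt_le_wt hjm hm).trans_lt (hj.resolve_left (by omega))
  have hpiece : (HY.F j).sub i ≤ HY.piece a i := by
    cases j with
    | zero => simp [HY.bot i]
    | succ j =>
      exact le_iSup₂ (f := fun k (_ : k ∈ {k | k < HY.s ∧ a ≤ HY.wt k}) => (HY.F (k + 1)).sub i)
        j (hmin j j.lt_succ_self)
  rw [Submodule.map_le_iff_le_comap]
  refine iSup₂_le fun k hk x hx => hpiece ?_
  exact HX.map_mem_of_wt HY f hjs hY hk.1
    (fun l hl => hk.2.trans (HX.wt_le_wt (Nat.lt_succ_iff.mp hl) hk.1)) i x hx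


end QuiverModuli
end

section
/- Let a cyclic quiver representation M(ω) be attached to an oriented cycle ω = α_s...α_1 in a quiver Q as follows: M(ω)_i has basis {b_k : k with i_k = i, 0 ≤ k ≤ s-1}, and M(ω)_α(b_k) = b_{k+1 mod s} if α = α_{k+1} and 0 otherwise. Then M(ω) ≅ M(ω') if and only if ω and ω' are cyclically equivalent. -/
/-! Basic framework for finite-dimensional representations of a quiver.
A quiver is given by a vertex type `I`, an arrow type `A` and
source/target maps `src tgt : A → I`. -/

noncomputable section QuiverModuli

variable (𝕜 : Type) [Field 𝕜] {I A : Type} (src tgt : A → I)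

variable {𝕜 src tgt}

variable {X Y : QRep 𝕜 src tgt}

variable [Fintype I]

/-- An oriented cycle in the quiver: a cyclic sequence of composable arrows of
positive length. -/
structure QCycle (src tgt : A → I) where
  len : ℕ
  pos : 0 < len
  arr : ZMod len → A
  compat : ∀ k, tgt (arr k) = src (arr (k + 1))

/-- Cyclic equivalence of cycles: same length and equal up to rotation. -/
def CyclicEquiv (ω ω' : QCycle src tgt) : Prop :=
  ω.len = ω'.len ∧ ∃ r : ℤ,
    ∀ k : ℤ, ω.arr ((k + r : ℤ) : ZMod ω.len) = ω'.arr ((k : ℤ) : ZMod ω'.len)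

/-- The representation `M(ω)` attached to an oriented cycle `ω`: at a vertex `i`
it has basis the indices `k` with `src (ω.arr k) = i`, and the arrow `a` sends
`b_k` to `b_{k+1}` if `ω.arr k = a` and to `0` otherwise. -/
def cycleRep (ω : QCycle src tgt) : QRep 𝕜 src tgt where
  V i := {k : ZMod ω.len // src (ω.arr k) = i} → 𝕜
  grp _ := inferInstance
  mod _ := inferInstance
  fin i := by
    haveI : NeZero ω.len := ⟨ω.pos.ne'⟩
    infer_instance
  map a := by
    classical
    exact LinearMap.pi fun k' : {k : ZMod ω.len // src (ω.arr k) = tgt a} =>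
      if h : ω.arr (k'.1 - 1) = a then
        LinearMap.proj (⟨k'.1 - 1, by rw [h]⟩ :
          {k : ZMod ω.len // src (ω.arr k) = src a})
      else 0

theorem cycleRep_map_apply (ω : QCycle src tgt) (a : A) (x : (cycleRep (𝕜 := 𝕜) ω).V (src a))
    (k : {k : ZMod ω.len // src (ω.arr k) = tgt a}) [Decidable (ω.arr (k.1 - 1) = a)] :
    (cycleRep (𝕜 := 𝕜) ω).map a x k =
      if h : ω.arr (k.1 - 1) = a then x ⟨k.1 - 1, by rw [h]⟩ else 0 := by
  change (@dite _ _ (Classical.propDecidable _) _ _ : ({k : ZMod ω.len // src (ω.arr k) = src a} → 𝕜) →ₗ[𝕜] 𝕜)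
    x = _
  by_cases h : ω.arr (k.1 - 1) = a
  · rw [dif_pos h, dif_pos h]
    rfl
  · rw [dif_neg h, dif_neg h]
    rfl

/-- The basis vector `b_k` of `M(ω)`, placed at a vertex equal to the source of the `k`-th arrow. -/
def cycleRepBasis (ω : QCycle src tgt) (k : ZMod ω.len) (i : I) (h : src (ω.arr k) = i) :
    (cycleRep (𝕜 := 𝕜) ω).V i := by
  classical
  exact Pi.single (M := fun _ => 𝕜) ⟨k, h⟩ 1

theorem cycleRepBasis_apply (ω : QCycle src tgt) (k : ZMod ω.len) (i : I)
    (h : src (ω.arr k) = i) (j : {k : ZMod ω.len // src (ω.arr k) = i}) [Decidable (j.1 = k)] :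
    cycleRepBasis (𝕜 := 𝕜) ω k i h j = if j.1 = k then 1 else 0 := by
  simp [cycleRepBasis, Pi.single_apply, Subtype.ext_iff]

theorem cycleRepBasis_ne_zero (ω : QCycle src tgt) (k : ZMod ω.len) (i : I)
    (h : src (ω.arr k) = i) : cycleRepBasis (𝕜 := 𝕜) ω k i h ≠ 0 := by
  classical
  intro h0
  have h1 := cycleRepBasis_apply (𝕜 := 𝕜) ω k i h ⟨k, h⟩
  rw [h0, if_pos rfl] at h1
  exact zero_ne_one h1

theorem cycleRep_map_basis (ω : QCycle src tgt) (k : ZMod ω.len) :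
    (cycleRep (𝕜 := 𝕜) ω).map (ω.arr k) (cycleRepBasis ω k _ rfl) =
      cycleRepBasis ω (k + 1) _ (ω.compat k).symm := by
  classical
  funext j
  rw [cycleRep_map_apply, cycleRepBasis_apply]
  by_cases hj : j.1 = k + 1
  · have hk : j.1 - 1 = k := by rw [hj, add_sub_cancel_right]
    rw [dif_pos (by rw [hk]), cycleRepBasis_apply, if_pos hk, if_pos hj]
  · rw [if_neg hj]
    split_ifs with h
    · rw [cycleRepBasis_apply, if_neg fun hk => hj (sub_eq_iff_eq_add.mp hk)]
    · rfl

/-- The image of `b_k` under `f` has a nonzero `b_j`-coordinate. -/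
def QHom.CoordNeZero {ω ω' : QCycle src tgt}
    (f : QHom (cycleRep (𝕜 := 𝕜) ω) (cycleRep (𝕜 := 𝕜) ω')) (k : ZMod ω.len)
    (j : ZMod ω'.len) : Prop :=
  ∃ (i : I) (hk : src (ω.arr k) = i) (hj : src (ω'.arr j) = i),
    f.f i (cycleRepBasis ω k i hk) ⟨j, hj⟩ ≠ (0 : 𝕜)

theorem QHom.CoordNeZero.pred {ω ω' : QCycle src tgt}
    {f : QHom (cycleRep (𝕜 := 𝕜) ω) (cycleRep (𝕜 := 𝕜) ω')} {k : ZMod ω.len} {j : ZMod ω'.len}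
    (h : f.CoordNeZero (k + 1) (j + 1)) : ω'.arr j = ω.arr k ∧ f.CoordNeZero k j := by
  classical
  obtain ⟨i, hk, hj, h⟩ := h
  obtain rfl : tgt (ω.arr k) = i := (ω.compat k).trans hk
  have hc := LinearMap.congr_fun (f.comm (ω.arr k)) (cycleRepBasis ω k _ rfl)
  rw [LinearMap.comp_apply, LinearMap.comp_apply, cycleRep_map_basis] at hc
  rw [hc, cycleRep_map_apply] at h
  split_ifs at h with ha
  · simp only [add_sub_cancel_right] at ha h
    exact ⟨ha, _, rfl, by rw [ha], h⟩
  · exact absurd rfl h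

/-- An injective morphism out of `M(ω)` matches the arrows of `ω'` with those of `ω`, read
backwards from the base point of `ω`. -/
theorem QHom.exists_arr_eq_of_injective {ω ω' : QCycle src tgt}
    (f : QHom (cycleRep (𝕜 := 𝕜) ω) (cycleRep (𝕜 := 𝕜) ω'))
    (hf : ∀ i, Function.Injective (f.f i)) :
    ∃ j : ZMod ω'.len, ∀ n : ℕ, ω'.arr (j - n - 1) = ω.arr (-n - 1) := by
  obtain ⟨⟨j, hj⟩, hne⟩ := Function.ne_iff.mp
    ((map_ne_zero_iff _ (hf _)).mpr (cycleRepBasis_ne_zero (𝕜 := 𝕜) ω 0 _ rfl))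
  have hstep (n : ℕ) (h : f.CoordNeZero (-n) (j - n)) :
      ω'.arr (j - n - 1) = ω.arr (-n - 1) ∧ f.CoordNeZero (-n - 1) (j - n - 1) :=
    QHom.CoordNeZero.pred (by rwa [sub_add_cancel, sub_add_cancel])
  have hcoord (n : ℕ) : f.CoordNeZero (-n) (j - n) := by
    induction n with
    | zero =>
      rw [Nat.cast_zero, Nat.cast_zero, neg_zero, sub_zero]
      exact ⟨_, rfl, hj, hne⟩
    | succ n ih =>
      convert (hstep n ih).2 using 1 <;> push_cast <;> ring
  exact ⟨j, fun n => (hstep n (hcoord n)).1⟩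

theorem sum_finrank_cycleRep (ω : QCycle src tgt) :
    ∑ i, Module.finrank 𝕜 ((cycleRep (𝕜 := 𝕜) ω).V i) = ω.len := by
  classical
  have : NeZero ω.len := ⟨ω.pos.ne'⟩
  calc ∑ i, Module.finrank 𝕜 ((cycleRep (𝕜 := 𝕜) ω).V i)
      = ∑ i, Fintype.card {k : ZMod ω.len // src (ω.arr k) = i} :=
        Finset.sum_congr rfl fun _ _ => Module.finrank_fintype_fun_eq_card 𝕜
    _ = Fintype.card (Σ i, {k : ZMod ω.len // src (ω.arr k) = i}) := Fintype.card_sigma.symm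
    _ = Fintype.card (ZMod ω.len) := Fintype.card_congr (Equiv.sigmaFiberEquiv _)
    _ = ω.len := ZMod.card _

theorem CyclicEquiv.exists_bijective_hom {ω ω' : QCycle src tgt} (h : CyclicEquiv ω ω') :
    ∃ f : QHom (cycleRep (𝕜 := 𝕜) ω) (cycleRep (𝕜 := 𝕜) ω'),
      ∀ i, Function.Bijective (f.f i) := by
  classical
  obtain ⟨n, hn, arr, harr⟩ := ω
  obtain ⟨n', hn', arr', harr'⟩ := ω'
  obtain ⟨hlen, r, hr⟩ := h
  dsimp only at hlen hr
  subst hlen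
  obtain rfl : arr' = fun k => arr (k + r) := by
    funext k
    obtain ⟨k, rfl⟩ := ZMod.intCast_surjective k
    rw [← hr k, Int.cast_add]
  let e (i : I) : {k : ZMod n // src (arr (k + r)) = i} ≃ {k : ZMod n // src (arr k) = i} :=
    (Equiv.addRight (r : ZMod n)).subtypeEquiv fun _ => Iff.rfl
  refine ⟨⟨fun i => LinearMap.funLeft 𝕜 𝕜 (e i), fun a => ?_⟩,
    fun i => (LinearEquiv.funCongrLeft 𝕜 𝕜 (e i)).bijective⟩
  refine LinearMap.ext fun x => funext fun k => ?_
  have hk : (e (tgt a) k).1 - 1 = k.1 - 1 + r := add_sub_right_comm _ _ _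
  refine (cycleRep_map_apply ⟨n, hn, arr, harr⟩ a x (e (tgt a) k)).trans ?_
  refine Eq.trans ?_ (cycleRep_map_apply ⟨n, hn', _, harr'⟩ a
    (LinearMap.funLeft 𝕜 𝕜 (e (src a)) x) k).symm
  simp only [hk]
  rfl

/-- `M(ω) ≅ M(ω')` if and only if the cycles `ω` and `ω'` are
cyclically equivalent. -/
theorem cycleRep_iso_iff [IsAlgClosed 𝕜] [CharZero 𝕜] (ω ω' : QCycle src tgt) :
    (∃ f : QHom (cycleRep (𝕜 := 𝕜) ω) (cycleRep (𝕜 := 𝕜) ω'),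
      ∀ i, Function.Bijective (f.f i)) ↔ CyclicEquiv ω ω' := by
  refine ⟨fun ⟨f, hf⟩ => ?_, CyclicEquiv.exists_bijective_hom⟩
  have hlen : ω.len = ω'.len := by
    rw [← sum_finrank_cycleRep (𝕜 := 𝕜) ω, ← sum_finrank_cycleRep (𝕜 := 𝕜) ω']
    exact Finset.sum_congr rfl fun i _ => (LinearEquiv.ofBijective (f.f i) (hf i)).finrank_eq
  obtain ⟨j, hj⟩ := f.exists_arr_eq_of_injective fun i => (hf i).injective
  obtain ⟨j, rfl⟩ := ZMod.intCast_surjective j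
  clear hf f
  obtain ⟨n, hn, arr, harr⟩ := ω
  obtain ⟨n', hn', arr', harr'⟩ := ω'
  dsimp only at hlen hj
  subst hlen
  have : NeZero n := ⟨hn.ne'⟩
  refine ⟨rfl, -j, fun k => ?_⟩
  have h := hj ((j - k - 1 : ℤ) : ZMod n).val
  rw [ZMod.natCast_zmod_val] at h
  push_cast at h ⊢
  convert h.symm using 2 <;> ring


end QuiverModuli
end
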